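/- For every choice of χ₀ ∈ {−1, 1}, ν ∈ {e^{iπ/4}, e^{−iπ/4}}, and ω₀, ω₁ ∈ {1, e^{2πi/3}, e^{4πi/3}}, there is no complex number a₃ satisfying both equations: 2−√5 = i − 2ν³χ₀ω₀·(2νχ₀ω₀²·(ā₃) + 2a₃ + (−2−i) + √5) and 2−√5 = −i − 2ν³χ₀ω₁·(2νχ₀ω₁²·(ā₃) + 2a₃ + (−2+i) + √5). -/

import Mathlib

open Complex in
/-- If `κ` is unimodular and `2 * b̄ - c̄ = 2 * κ * b` for some `b`, then `κ * c = -c̄`. -/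
lemma mul_eq_neg_conj_of_two_mul_conj_sub {κ b c : ℂ} (hκ : ‖κ‖ = 1)
    (h : 2 * starRingEnd ℂ b - starRingEnd ℂ c = 2 * κ * b) :
    κ * c = -starRingEnd ℂ c := by
  have hκ' : κ * starRingEnd ℂ κ = 1 := by simp [mul_conj, normSq_eq_norm_sq, hκ]
  have h' := congrArg (starRingEnd ℂ) h
  simp only [map_sub, map_mul, conj_conj, map_ofNat] at h'
  linear_combination -h - κ * h' - 2 * starRingEnd ℂ b * hκ'

open Complex in
/-- The ratio of `√5 - 2 + i` to its conjugate is not a twelfth root of `-1`. -/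
lemma sqrt_five_sub_two_add_I_pow_ne :
    ((Real.sqrt 5 : ℂ) - 2 + I) ^ 12 ≠ -((Real.sqrt 5 : ℂ) - 2 - I) ^ 12 := by
  intro h
  set s : ℂ := (Real.sqrt 5 : ℂ) with hs_def
  have hs : s ^ 2 = 5 := by
    rw [hs_def, ← ofReal_pow, Real.sq_sqrt (by norm_num)]
    norm_num
  have hs2 : s - 2 ≠ 0 := by
    intro h0
    have h1 : s = 2 := by linear_combination h0
    norm_num [h1] at hs
  have hplus : (s - 2 + I) ^ 2 = (s - 2) * (-4 + 2 * I) := by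
    linear_combination hs + I_sq
  have hminus : (s - 2 - I) ^ 2 = (s - 2) * (-4 - 2 * I) := by
    linear_combination hs + I_sq
  have hI : (-4 + 2 * I) ^ 6 + (-4 - 2 * I) ^ 6 = -14976 := by
    linear_combination (128 * I ^ 4 + 7552 * I ^ 2 + 23168) * I_sq
  have hzero : (s - 2) ^ 6 * (-14976) = 0 := by
    rw [← hI, mul_add, ← mul_pow, ← mul_pow, ← hplus, ← hminus]
    linear_combination h
  simp [hs2] at hzero


/-- Non-existence of a solution `a₃` to the pair of equations arising in the non-self-dual
case `m = 2`, `χ₀ = χ₁`, for every choice of `χ₀ ∈ {±1}`, `ν ∈ {e^{±iπ/4}}` and third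
roots of unity `ω₀, ω₁`. -/
theorem stmt_16 (χ₀ ν ω₀ ω₁ : ℂ)
    (hχ : χ₀ = -1 ∨ χ₀ = 1)
    (hν : ν = Complex.exp ((Real.pi : ℂ) * Complex.I / 4) ∨
      ν = Complex.exp (-((Real.pi : ℂ) * Complex.I / 4)))
    (hω₀ : ω₀ = 1 ∨ ω₀ = Complex.exp (2 * (Real.pi : ℂ) * Complex.I / 3) ∨
      ω₀ = Complex.exp (4 * (Real.pi : ℂ) * Complex.I / 3))
    (hω₁ : ω₁ = 1 ∨ ω₁ = Complex.exp (2 * (Real.pi : ℂ) * Complex.I / 3) ∨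
      ω₁ = Complex.exp (4 * (Real.pi : ℂ) * Complex.I / 3)) :
    ¬ ∃ a₃ : ℂ,
      (((2 - Real.sqrt 5 : ℝ)) : ℂ) =
        Complex.I - 2 * ν ^ 3 * χ₀ * ω₀ *
          (2 * ν * χ₀ * ω₀ ^ 2 * starRingEnd ℂ a₃ + 2 * a₃ + (-2 - Complex.I) +
            ((Real.sqrt 5 : ℝ) : ℂ)) ∧
      (((2 - Real.sqrt 5 : ℝ)) : ℂ) =
        -Complex.I - 2 * ν ^ 3 * χ₀ * ω₁ *
          (2 * ν * χ₀ * ω₁ ^ 2 * starRingEnd ℂ a₃ + 2 * a₃ + (-2 + Complex.I) +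
            ((Real.sqrt 5 : ℝ) : ℂ)) := by
  rintro ⟨a, h, -⟩
  have hχ2 : χ₀ ^ 2 = 1 := by rcases hχ with rfl | rfl <;> norm_num
  have hν4 : ν ^ 4 = -1 := by
    rcases hν with rfl | rfl
    · rw [← Complex.exp_nat_mul, ← Complex.exp_pi_mul_I]
      congr 1
      push_cast
      ring
    · rw [← Complex.exp_nat_mul, ← Complex.exp_neg_pi_mul_I]
      congr 1
      push_cast
      ring
  have hω3 : ω₀ ^ 3 = 1 := by
    rcases hω₀ with rfl | rfl | rfl
    · norm_num
    · rw [← Complex.exp_nat_mul, ← Complex.exp_two_pi_mul_I]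
      congr 1
      push_cast
      ring
    · rw [← Complex.exp_nat_mul, Complex.exp_eq_one_iff]
      refine ⟨2, ?_⟩
      push_cast
      ring
  have hκ12 : (ν ^ 3 * χ₀ * ω₀) ^ 12 = -1 := by
    calc (ν ^ 3 * χ₀ * ω₀) ^ 12 = (ν ^ 4) ^ 9 * (χ₀ ^ 2) ^ 6 * (ω₀ ^ 3) ^ 4 := by ring
      _ = -1 := by rw [hν4, hχ2, hω3]; norm_num
  have hκ : ‖ν ^ 3 * χ₀ * ω₀‖ = 1 := by
    refine Complex.norm_eq_one_of_pow_eq_one (n := 24) ?_ (by norm_num)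
    rw [show 24 = 12 * 2 from rfl, pow_mul, hκ12]
    norm_num
  have hprod : ν ^ 4 * χ₀ ^ 2 * ω₀ ^ 3 = -1 := by rw [hν4, hχ2, hω3]; norm_num
  have hc := mul_eq_neg_conj_of_two_mul_conj_sub (b := 2 * a + ((Real.sqrt 5 : ℂ) - 2 - Complex.I))
    (c := (Real.sqrt 5 : ℂ) - 2 - Complex.I) hκ (by
      simp only [map_add, map_sub, map_mul, map_ofNat, Complex.conj_I, Complex.conj_ofReal]
      push_cast at h
      linear_combination -h + 4 * starRingEnd ℂ a * hprod)
  simp only [map_sub, map_ofNat, Complex.conj_I, Complex.conj_ofReal, sub_neg_eq_add] at hc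
  apply sqrt_five_sub_two_add_I_pow_ne
  have hpow := congrArg (· ^ 12) hc
  simp only [mul_pow _ ((Real.sqrt 5 : ℂ) - 2 - Complex.I), hκ12] at hpow
  linear_combination -hpow
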